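/- Let K be a field of characteristic zero, V a finite-dimensional K-vector space, and let z ∈ T(V) be either a nonzero element of V, or a nonzero antisymmetric 2-tensor (a nonzero element of Λ²V). Then the centralizer of Δz in T(V) ⊗_K T(V) equals K[z] ⊗_K K[z]; that is, {u ∈ T(V) ⊗_K T(V) : (Δz)u − u(Δz) = 0} = K[z] ⊗_K K[z]. (Lemma 3.6, stated in the uncompleted tensor algebra; since z is homogeneous, this is equivalent to the completed version.) -/

import Mathlib

/-!
STATEMENT 3 (Lemma 3.6): if `z` is a nonzero element of `V`, or a nonzero antisymmetric
2-tensor, then the centralizer of `Δz` in `T(V) ⊗ T(V)` is `K[z] ⊗ K[z]`.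
-/

noncomputable section

open scoped TensorProduct

variable (K : Type*) [Field K] [CharZero K]
variable (V : Type*) [AddCommGroup V] [Module K V]

/-- The standard coproduct `Δ : T(V) → T(V) ⊗ T(V)`, the unique algebra homomorphism with
`Δ(v) = v ⊗ 1 + 1 ⊗ v` for `v ∈ V`. -/
def Delta : TensorAlgebra K V →ₐ[K] TensorAlgebra K V ⊗[K] TensorAlgebra K V :=
  TensorAlgebra.lift K
    ((Algebra.TensorProduct.includeLeft
        (R := K) (S := K) (A := TensorAlgebra K V) (B := TensorAlgebra K V)).toLinearMap
          ∘ₗ TensorAlgebra.ι K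
      + (Algebra.TensorProduct.includeRight
        (R := K) (A := TensorAlgebra K V) (B := TensorAlgebra K V)).toLinearMap
          ∘ₗ TensorAlgebra.ι K)

/-- The subspace `Λ²V ⊆ V^{⊗2}` of antisymmetric 2-tensors. -/
def lambdaTwo : Submodule K (TensorAlgebra K V) :=
  Submodule.span K
    {x | ∃ v w : V, x = TensorAlgebra.ι K v * TensorAlgebra.ι K w
                      - TensorAlgebra.ι K w * TensorAlgebra.ι K v}

section LinearMaps

variable {F M : Type*} [Field F] [AddCommGroup M] [Module F M]

/-- Every linear endomorphism over a field is von Neumann regular. -/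
theorem exists_comp_comp_eq_self (A : M →ₗ[F] M) : ∃ C : M →ₗ[F] M, A ∘ₗ C ∘ₗ A = A := by
  obtain ⟨s, hs⟩ := A.rangeRestrict.exists_rightInverse_of_surjective A.range_rangeRestrict
  obtain ⟨C, hC⟩ := LinearMap.exists_extend s
  refine ⟨C, LinearMap.ext fun x => ?_⟩
  have h1 : C (A x) = s (A.rangeRestrict x) := LinearMap.congr_fun hC (A.rangeRestrict x)
  have h2 := congrArg Subtype.val (LinearMap.congr_fun hs (A.rangeRestrict x))
  simpa [h1] using h2

/-- If `ker A² = ker A` and `A` raises a filtration detected by the truncations `τ`, then the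
kernel of `A ⊗ 1 + 1 ⊗ A` consists of elements killed by both summands. -/
theorem rTensor_eq_zero_of_add_eq_zero (A : M →ₗ[F] M)
    (hA : ∀ x, A (A x) = 0 → A x = 0)
    (τ : ℕ → M →ₗ[F] M) (hτ : ∀ n x, τ n ((A ^ n) x) = 0)
    (hτ' : ∀ x, ∃ N, ∀ n, N ≤ n → τ n x = x)
    (u : M ⊗[F] M) (hu : A.rTensor M u + A.lTensor M u = 0) : A.rTensor M u = 0 := by
  set P := A.rTensor M with hP
  set Q := A.lTensor M with hQ
  have hcomm : ∀ (B C : M →ₗ[F] M) (x : M ⊗[F] M),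
      B.rTensor M (C.lTensor M x) = C.lTensor M (B.rTensor M x) := fun B C x => by
    rw [← LinearMap.comp_apply, ← LinearMap.comp_apply, LinearMap.rTensor_comp_lTensor,
      LinearMap.lTensor_comp_rTensor]
  have htrunc : ∃ N, ∀ n, N ≤ n → (τ n).rTensor M u = u := by
    clear hu
    induction u using TensorProduct.induction_on with
    | zero => exact ⟨0, by simp⟩
    | tmul x y =>
      obtain ⟨N, hN⟩ := hτ' x
      exact ⟨N, fun n hn => by simp [hN n hn]⟩
    | add x y hx hy =>
      obtain ⟨N, hN⟩ := hx
      obtain ⟨N', hN'⟩ := hy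
      exact ⟨max N N', fun n hn => by
        rw [map_add, hN n (le_of_max_le_left hn), hN' n (le_of_max_le_right hn)]⟩
  obtain ⟨N, hN⟩ := htrunc
  have hpow : ∀ n, (P ^ n) u = (-1 : F) ^ n • (Q ^ n) u := by
    intro n
    induction n with
    | zero => simp
    | succ n ih =>
      have hPu : P u = -Q u := eq_neg_of_add_eq_zero_left hu
      have hPQ : P ((Q ^ n) u) = (Q ^ n) (P u) := by
        rw [hP, hQ, LinearMap.lTensor_pow, hcomm]
      rw [pow_succ' P, Module.End.mul_apply, ih, map_smul, hPQ, hPu, map_neg, pow_succ Q,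
        Module.End.mul_apply, pow_succ]
      simp
  have hPpow : ∀ n, N ≤ n → (P ^ n) u = 0 := by
    intro n hn
    have h1 : (τ n).rTensor M ((P ^ n) u) = 0 := by
      have h0 : (τ n) ∘ₗ (A ^ n) = 0 := LinearMap.ext (hτ n)
      rw [hP, LinearMap.rTensor_pow, ← LinearMap.comp_apply, ← LinearMap.rTensor_comp, h0]
      simp
    rw [hpow, map_smul, hQ, LinearMap.lTensor_pow, hcomm, hN n hn, ← LinearMap.lTensor_pow,
      ← hQ, ← hpow] at h1
    exact h1
  obtain ⟨C, hC⟩ := exists_comp_comp_eq_self (A ∘ₗ A)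
  have hB : A = (A ∘ₗ C) ∘ₗ A ∘ₗ A := by
    refine LinearMap.ext fun x => ?_
    have h := LinearMap.congr_fun hC x
    simp only [LinearMap.comp_apply] at h
    have h2 := hA (x - C (A (A x))) (by simp [h])
    simpa [sub_eq_zero] using h2
  have hPP : ∀ x, P (P x) = 0 → P x = 0 := fun x hx => by
    have : P = ((A ∘ₗ C).rTensor M) ∘ₗ P ∘ₗ P := by
      rw [hP, ← LinearMap.rTensor_comp, ← LinearMap.rTensor_comp, ← hB]
    rw [this, LinearMap.comp_apply, LinearMap.comp_apply, hx, map_zero]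
  have hdesc : ∀ n, (P ^ (n + 1)) u = 0 → P u = 0 := by
    intro n
    induction n with
    | zero => simp
    | succ n ih =>
      intro h
      apply ih
      rw [pow_succ', Module.End.mul_apply]
      apply hPP
      rw [pow_succ', pow_succ'] at h
      exact h
  exact hdesc N (hPpow _ (Nat.le_succ N))

/-- The intersection of `ker (A ⊗ 1)` and `ker (1 ⊗ A)` is spanned by `ker A ⊗ ker A`. -/
theorem mem_span_tmul_ker (A : M →ₗ[F] M) (u : M ⊗[F] M) (h1 : A.rTensor M u = 0)
    (h2 : A.lTensor M u = 0) :
    u ∈ Submodule.span F {x | ∃ a b, A a = 0 ∧ A b = 0 ∧ x = a ⊗ₜ[F] b} := by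
  obtain ⟨C, hC⟩ := exists_comp_comp_eq_self A
  have hC' : ∀ x, A (C (A x)) = A x := LinearMap.congr_fun hC
  set p : M →ₗ[F] M := LinearMap.id - C ∘ₗ A with hp
  have hl : p.lTensor M u = u := by
    rw [hp, LinearMap.lTensor_sub, LinearMap.lTensor_comp]
    simp [h2]
  have hr : p.rTensor M u = u := by
    rw [hp, LinearMap.rTensor_sub, LinearMap.rTensor_comp]
    simp [h1]
  have hm : TensorProduct.map p p u = u := by
    rw [← LinearMap.rTensor_comp_lTensor, LinearMap.comp_apply, hl, hr]
  rw [← hm]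
  clear hm hl hr h1 h2
  induction u using TensorProduct.induction_on with
  | zero => simp
  | tmul x y => exact Submodule.subset_span ⟨p x, p y, by simp [hp, hC'], by simp [hp, hC'], rfl⟩
  | add x y hx hy => rw [map_add]; exact add_mem hx hy

end LinearMaps

section TensorAlgebra

open TensorAlgebra Polynomial

variable {F W : Type*} [Field F] [AddCommGroup W] [Module F W]

/-- The matrix-valued algebra homomorphism `a ↦ !![a, ∂a; 0, ε a]` encoding the skew
derivation `∂` with `∂(a v) = f v • a`. -/
def rightDerivMatrix (f : Module.Dual F W) :
    TensorAlgebra F W →ₐ[F] Matrix (Fin 2) (Fin 2) (TensorAlgebra F W) :=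
  lift F
    { toFun := fun v => !![ι F v, algebraMap F _ (f v); 0, 0]
      map_add' := fun v w => by ext i j; fin_cases i <;> fin_cases j <;> simp
      map_smul' := fun c v => by
        ext i j; fin_cases i <;> fin_cases j <;> simp [Algebra.smul_def] }

theorem rightDerivMatrix_ι (f : Module.Dual F W) (v : W) :
    rightDerivMatrix f (ι F v) = !![ι F v, algebraMap F _ (f v); 0, 0] := by
  simp [rightDerivMatrix]

theorem rightDerivMatrix_entries (f : Module.Dual F W) (a : TensorAlgebra F W) :
    rightDerivMatrix f a 0 0 = a ∧ rightDerivMatrix f a 1 0 = 0 ∧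
      rightDerivMatrix f a 1 1 = algebraMap F _ (algebraMapInv a) := by
  induction a using TensorAlgebra.induction with
  | algebraMap r => simp [Matrix.algebraMap_matrix_apply, algebraMapInv]
  | ι v => simp [rightDerivMatrix_ι, algebraMapInv]
  | mul a b ha hb =>
    simp only [map_mul, Matrix.mul_apply, Fin.sum_univ_two]
    simp [ha, hb]
  | add a b ha hb => simp [ha, hb]

/-- The skew derivation `∂` of the tensor algebra with `∂(a v) = f v • a` and `∂ 1 = 0`. -/
def rightDeriv (f : Module.Dual F W) : TensorAlgebra F W →ₗ[F] TensorAlgebra F W where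
  toFun a := rightDerivMatrix f a 0 1
  map_add' a b := by simp
  map_smul' c a := by simp

theorem rightDeriv_ι (f : Module.Dual F W) (v : W) :
    rightDeriv f (ι F v) = algebraMap F _ (f v) := by
  simp [rightDeriv, rightDerivMatrix_ι]

theorem rightDeriv_mul (f : Module.Dual F W) (a b : TensorAlgebra F W) :
    rightDeriv f (a * b) = a * rightDeriv f b + algebraMapInv b • rightDeriv f a := by
  simp only [rightDeriv, LinearMap.coe_mk, AddHom.coe_mk, map_mul, Matrix.mul_apply,
    Fin.sum_univ_two, (rightDerivMatrix_entries f _).1, (rightDerivMatrix_entries f _).2.2]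
  rw [Algebra.smul_def, Algebra.commutes]

theorem rightDeriv_algebraMap (f : Module.Dual F W) (r : F) :
    rightDeriv f (algebraMap F (TensorAlgebra F W) r) = 0 := by
  simp [rightDeriv, Matrix.algebraMap_matrix_apply]

theorem algebraMapInv_ι (v : W) : algebraMapInv (ι F v) = 0 := by
  simp [algebraMapInv]

theorem exists_dual_eq_one {v : W} (hv : v ≠ 0) : ∃ f : Module.Dual F W, f v = 1 := by
  obtain ⟨f, hf⟩ := not_forall.mp (mt (Module.forall_dual_apply_eq_zero_iff F v).mp hv)
  exact ⟨(f v)⁻¹ • f, by simp [inv_mul_cancel₀ hf]⟩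

/-- The homomorphism `v ↦ v X` recording degrees. -/
def gradingHom : TensorAlgebra F W →ₐ[F] (TensorAlgebra F W)[X] :=
  lift F ((LinearMap.mulRight F (X : (TensorAlgebra F W)[X])) ∘ₗ
    (Polynomial.CAlgHom (R := F) (A := TensorAlgebra F W)).toLinearMap ∘ₗ ι F)

theorem gradingHom_ι (v : W) : gradingHom (ι F v) = C (ι F v) * X := by
  simp [gradingHom]

theorem eval_one_gradingHom (a : TensorAlgebra F W) : (gradingHom a).eval 1 = a := by
  induction a using TensorAlgebra.induction with
  | algebraMap r => simp [Polynomial.algebraMap_apply]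
  | ι v => simp [gradingHom_ι]
  | mul a b ha hb =>
    rw [map_mul, Polynomial.eval, Polynomial.eval₂_mul_noncomm _ _ fun _ => Commute.one_right _]
    exact congrArg₂ (· * ·) ha hb
  | add a b ha hb => simp [ha, hb]

/-- The truncation of a tensor to its components of degree less than `n`. -/
def truncation (n : ℕ) : TensorAlgebra F W →ₗ[F] TensorAlgebra F W where
  toFun a := ∑ k ∈ Finset.range n, (gradingHom a).coeff k
  map_add' a b := by simp [Finset.sum_add_distrib]
  map_smul' c a := by simp [Finset.smul_sum]

theorem truncation_eq_self (a : TensorAlgebra F W) :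
    ∃ N, ∀ n, N ≤ n → truncation n a = a :=
  ⟨(gradingHom a).natDegree + 1, fun n hn => by
    conv_rhs => rw [← eval_one_gradingHom a,
      Polynomial.eval_eq_sum_range' (Nat.lt_of_succ_le hn)]
    simp [truncation]⟩

/-- The endomorphism `a ↦ z a - a z`. -/
def adMap (z : TensorAlgebra F W) : TensorAlgebra F W →ₗ[F] TensorAlgebra F W :=
  LinearMap.mulLeft F z - LinearMap.mulRight F z

theorem adMap_apply (z a : TensorAlgebra F W) : adMap z a = z * a - a * z := rfl

theorem coeff_gradingHom_adMap_pow {z : TensorAlgebra F W} {d : ℕ} (hd : 0 < d)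
    (hz : gradingHom z = C z * X ^ d) (n : ℕ) (a : TensorAlgebra F W) :
    ∀ k < n, (gradingHom ((adMap z ^ n) a)).coeff k = 0 := by
  induction n with
  | zero => simp
  | succ n ih =>
    intro k hk
    set b := (adMap z ^ n) a with hb
    have h : gradingHom ((adMap z ^ (n + 1)) a)
        = (C z * gradingHom b - gradingHom b * C z) * X ^ d := by
      rw [pow_succ', Module.End.mul_apply, ← hb, adMap_apply, map_sub, map_mul, map_mul, hz,
        sub_mul, mul_assoc, (Polynomial.commute_X_pow (gradingHom b) d).eq]
      simp only [mul_assoc]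
    rw [h, Polynomial.coeff_mul_X_pow']
    split_ifs with hdk
    · have h0 := ih (k - d) (by omega)
      simp [h0]
    · rfl

theorem truncation_adMap_pow {z : TensorAlgebra F W} {d : ℕ} (hd : 0 < d)
    (hz : gradingHom z = C z * X ^ d) (n : ℕ) (a : TensorAlgebra F W) :
    truncation n ((adMap z ^ n) a) = 0 :=
  Finset.sum_eq_zero fun k hk =>
    coeff_gradingHom_adMap_pow hd hz n a k (Finset.mem_range.mp hk)

/-- Left divisibility modulo scalars: the only solutions of `a z ∈ z T(V)` lie in
`z T(V) + K`. -/
def DivisionProperty (z : TensorAlgebra F W) : Prop :=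
  ∀ a a', a * z = z * a' → ∃ b t, a = z * b + algebraMap F _ t

theorem exists_aeval_eq_of_commute {z : TensorAlgebra F W} (hz0 : z ≠ 0) {d : ℕ} (hd : 0 < d)
    (hz : gradingHom z = C z * X ^ d) (hdiv : DivisionProperty z) (a : TensorAlgebra F W)
    (ha : adMap z a = 0) : ∃ p : F[X], a = aeval z p := by
  induction hn : (gradingHom a).natDegree using Nat.strong_induction_on generalizing a with
  | _ n ih =>
    rw [adMap_apply, sub_eq_zero] at ha
    obtain ⟨b, t, rfl⟩ := hdiv a a ha.symm
    by_cases hb : b = 0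
    · exact ⟨C t, by simp [hb]⟩
    have hcb : adMap z b = 0 := by
      rw [adMap_apply]
      apply mul_left_cancel₀ hz0
      rw [mul_add, add_mul, ← Algebra.commutes] at ha
      rw [mul_sub, mul_zero, sub_eq_zero, ← mul_assoc z b z]
      exact add_right_cancel ha
    have hb' : gradingHom b ≠ 0 := fun h => hb (by
      rw [← eval_one_gradingHom b, h, Polynomial.eval_zero])
    have hdeg : (gradingHom (z * b + algebraMap F _ t)).natDegree
        = (gradingHom b).natDegree + d := by
      rw [map_add, AlgHom.commutes, Polynomial.algebraMap_apply, Polynomial.natDegree_add_C,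
        map_mul, hz, mul_assoc, Polynomial.natDegree_C_mul hz0,
        (Polynomial.commute_X_pow (gradingHom b) d).eq, Polynomial.natDegree_mul_X_pow d hb']
    obtain ⟨p, hp⟩ := ih _ (by omega) b hcb rfl
    exact ⟨X * p + C t, by simp [hp]⟩

theorem adMap_eq_zero_of_eq_aeval {z : TensorAlgebra F W} (hz0 : z ≠ 0)
    (hε : algebraMapInv z = 0) (hdiv : DivisionProperty z) (n : ℕ) :
    ∀ (p : F[X]) (a : TensorAlgebra F W), p.natDegree ≤ n → adMap z a = aeval z p →
      adMap z a = 0 := by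
  have hconst : ∀ (p : F[X]) (a : TensorAlgebra F W), adMap z a = aeval z p →
      p.coeff 0 = 0 := fun p a h => by
    have h1 := congrArg algebraMapInv h
    rw [adMap_apply, map_sub, map_mul, map_mul, hε, ← Polynomial.aeval_algHom_apply, hε] at h1
    simpa [Polynomial.coeff_zero_eq_aeval_zero] using h1.symm
  induction n with
  | zero =>
    intro p a hp h
    rw [h, Polynomial.eq_C_of_natDegree_le_zero hp, hconst p a h]
    simp
  | succ n ih =>
    intro p a hp h
    have hpX : p = X * p.divX := by
      conv_lhs => rw [← Polynomial.X_mul_divX_add p, hconst p a h]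
      simp
    have hq : z * a - a * z = z * aeval z p.divX := by
      rw [← adMap_apply, h]
      conv_lhs => rw [hpX]
      simp
    obtain ⟨b, t, hb⟩ := hdiv a (a - aeval z p.divX) (by rw [mul_sub, ← hq]; abel)
    have hbq : adMap z b = aeval z p.divX := by
      apply mul_left_cancel₀ hz0
      rw [← hq, hb, adMap_apply, mul_add, add_mul, ← Algebra.commutes]
      noncomm_ring
    have hdeg : p.divX.natDegree ≤ n := by
      rw [Polynomial.natDegree_divX_eq_natDegree_tsub_one]; omega
    rw [adMap_apply, hq, ← hbq, ih _ b hdeg hbq, mul_zero]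

theorem divisionProperty_ι {v : W} (hv : v ≠ 0) : DivisionProperty (ι F v) := by
  obtain ⟨f, hf⟩ := exists_dual_eq_one (F := F) hv
  intro a a' h
  have h1 := congrArg (rightDeriv f) h
  simp only [rightDeriv_mul, rightDeriv_ι, hf, algebraMapInv_ι, map_one, mul_one, zero_smul,
    add_zero] at h1
  exact ⟨rightDeriv f a', algebraMapInv a', by rw [h1, Algebra.smul_def, mul_one]⟩

theorem mul_ne_mul_of_rightDeriv_eq_ι {z : TensorAlgebra F W} (hε : algebraMapInv z = 0)
    (hD : ∀ g : Module.Dual F W, ∃ w, rightDeriv g z = ι F w ∧ g w = 0)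
    {f : Module.Dual F W} {w : W} (hw0 : w ≠ 0) (hw : rightDeriv f z = ι F w)
    (hfw : f w = 0) (b : TensorAlgebra F W) : ι F w * z ≠ z * b := by
  obtain ⟨g, hg⟩ := exists_dual_eq_one (F := F) hw0
  -- applying `ε ∘ ∂_g` annihilates the right ideal generated by `z`
  have hεD : ∀ y, algebraMapInv (rightDeriv g (z * y)) = 0 := fun y => by
    obtain ⟨w', hw', -⟩ := hD g
    simp [rightDeriv_mul, hε, hw', algebraMapInv_ι]
  intro h
  have h1 := congrArg (rightDeriv f) h
  simp only [rightDeriv_mul, hε, hw, zero_smul, add_zero] at h1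
  have h2 := congrArg (rightDeriv f) h1
  rw [map_add, map_smul] at h2
  simp only [rightDeriv_mul f (ι F w), rightDeriv_ι, hfw, algebraMapInv_ι, map_zero,
    mul_zero, smul_zero, add_zero] at h2
  rw [rightDeriv_mul, hw] at h2
  have h3 := congrArg (fun x => algebraMapInv (rightDeriv g x)) h2
  simp only [map_zero, map_add, hεD, map_smul, rightDeriv_ι, hg, map_one, zero_add, smul_eq_mul,
    mul_one] at h3
  have h4 := congrArg (rightDeriv g) h1
  simp only [rightDeriv_mul, map_add, map_smul, rightDeriv_ι, hg, algebraMapInv_ι, map_one,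
    mul_one, zero_smul, add_zero, ← h3] at h4
  have h5 := congrArg (fun x => algebraMapInv (rightDeriv g x)) h4
  simp [hεD, rightDeriv_ι, hg, ← Algebra.algebraMap_eq_smul_one, rightDeriv_algebraMap] at h5

theorem divisionProperty_of_rightDeriv_eq_ι {z : TensorAlgebra F W} (hε : algebraMapInv z = 0)
    (hD : ∀ g : Module.Dual F W, ∃ w, rightDeriv g z = ι F w ∧ g w = 0)
    {f : Module.Dual F W} (hf : rightDeriv f z ≠ 0) : DivisionProperty z := by
  obtain ⟨w, hw, hfw⟩ := hD f
  have hw0 : w ≠ 0 := fun h => hf (by rw [hw, h, map_zero])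
  obtain ⟨g, hg⟩ := exists_dual_eq_one (F := F) hw0
  obtain ⟨w', hw', hgw'⟩ := hD g
  intro a a' h
  have h1 := congrArg (fun x => rightDeriv g (rightDeriv f x)) h
  simp only [rightDeriv_mul, map_add, map_smul, hε, hw, hw', rightDeriv_ι, hg, algebraMapInv_ι,
    map_one, mul_one, zero_smul, add_zero, ← Algebra.algebraMap_eq_smul_one] at h1
  set s := algebraMapInv (rightDeriv f a')
  have hsw : s • ι F w' = 0 := by
    by_contra hne
    have hs0 : s ≠ 0 := fun h => hne (by rw [h, zero_smul])
    have hw'0 : w' ≠ 0 := fun h => hne (by rw [h, map_zero, smul_zero])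
    refine mul_ne_mul_of_rightDeriv_eq_ι hε hD hw'0 hw' hgw'
      (s⁻¹ • (a' - rightDeriv g (rightDeriv f a') * z - algebraMap F _ (algebraMapInv a'))) ?_
    rw [mul_smul_comm, mul_sub, mul_sub, ← h, ← Algebra.commutes]
    conv_rhs => rw [h1]
    rw [add_mul, add_mul, mul_assoc, smul_mul_assoc, add_sub_right_comm, add_sub_cancel_right,
      add_sub_cancel_left, inv_smul_smul₀ hs0]
  exact ⟨_, _, by rw [hsw, add_zero] at h1; exact h1⟩

end TensorAlgebra

section LambdaTwo

open TensorAlgebra Polynomial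

variable {K V}
omit [CharZero K]

theorem algebraMapInv_eq_zero_of_mem_lambdaTwo {z : TensorAlgebra K V} (hz : z ∈ lambdaTwo K V) :
    algebraMapInv z = 0 := by
  induction hz using Submodule.span_induction with
  | mem x hx => obtain ⟨v, w, rfl⟩ := hx; simp [algebraMapInv_ι]
  | zero => simp
  | add x y _ _ hx hy => simp [hx, hy]
  | smul c x _ hx => simp [hx]

theorem gradingHom_of_mem_lambdaTwo {z : TensorAlgebra K V} (hz : z ∈ lambdaTwo K V) :
    gradingHom z = C z * X ^ 2 := by
  induction hz using Submodule.span_induction with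
  | mem x hx =>
    obtain ⟨v, w, rfl⟩ := hx
    have h : ∀ v w : V, gradingHom (ι K v * ι K w) = C (ι K v * ι K w) * X ^ 2 := fun v w => by
      rw [map_mul, gradingHom_ι, gradingHom_ι, C_mul, sq, mul_assoc, ← mul_assoc X,
        Polynomial.X_mul, mul_assoc, mul_assoc]
    rw [map_sub, h, h, C_sub, sub_mul]
  | zero => simp
  | add x y _ _ hx hy => rw [map_add, hx, hy, C_add, add_mul]
  | smul c x _ hx => rw [map_smul, hx, ← Polynomial.smul_C, smul_mul_assoc]

theorem rightDeriv_of_mem_lambdaTwo {z : TensorAlgebra K V} (hz : z ∈ lambdaTwo K V)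
    (f : Module.Dual K V) : ∃ w, rightDeriv f z = ι K w ∧ f w = 0 := by
  induction hz using Submodule.span_induction with
  | mem x hx =>
    obtain ⟨v, w, rfl⟩ := hx
    refine ⟨f w • v - f v • w, ?_, by simp [mul_comm]⟩
    simp [rightDeriv_mul, rightDeriv_ι, algebraMapInv_ι, Algebra.smul_def, Algebra.commutes]
  | zero => exact ⟨0, by simp⟩
  | add x y _ _ hx hy =>
    obtain ⟨v, hv, hv'⟩ := hx
    obtain ⟨w, hw, hw'⟩ := hy
    exact ⟨v + w, by simp [hv, hw], by simp [hv', hw']⟩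
  | smul c x _ hx =>
    obtain ⟨v, hv, hv'⟩ := hx
    exact ⟨c • v, by simp [hv], by simp [hv']⟩

theorem sum_rightDeriv_mul_of_mem_lambdaTwo {κ : Type*} [Fintype κ] (b : Module.Basis κ K V)
    {z : TensorAlgebra K V} (hz : z ∈ lambdaTwo K V) :
    ∑ i, rightDeriv (b.coord i) z * ι K (b i) = z := by
  induction hz using Submodule.span_induction with
  | mem x hx =>
    obtain ⟨v, w, rfl⟩ := hx
    have h : ∀ v w : V, ∑ i, rightDeriv (b.coord i) (ι K v * ι K w) * ι K (b i)
        = ι K v * ι K w := fun v w => by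
      conv_rhs => rw [← b.sum_repr w]
      rw [map_sum, Finset.mul_sum]
      refine Finset.sum_congr rfl fun i _ => ?_
      simp [rightDeriv_mul, rightDeriv_ι, algebraMapInv_ι, Algebra.smul_def, mul_assoc]
    simp only [map_sub, sub_mul, Finset.sum_sub_distrib, h]
  | zero => simp
  | add x y _ _ hx hy => simp only [map_add, add_mul, Finset.sum_add_distrib, hx, hy]
  | smul c x _ hx => simp only [map_smul, smul_mul_assoc, ← Finset.smul_sum, hx]

theorem divisionProperty_of_mem_lambdaTwo [FiniteDimensional K V] {z : TensorAlgebra K V}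
    (hz0 : z ≠ 0) (hz : z ∈ lambdaTwo K V) : DivisionProperty z := by
  have hf : ∃ f : Module.Dual K V, rightDeriv f z ≠ 0 := by
    by_contra! h
    exact hz0 (by rw [← sum_rightDeriv_mul_of_mem_lambdaTwo (Module.finBasis K V) hz]; simp [h])
  obtain ⟨f, hf⟩ := hf
  exact divisionProperty_of_rightDeriv_eq_ι (algebraMapInv_eq_zero_of_mem_lambdaTwo hz)
    (rightDeriv_of_mem_lambdaTwo hz) hf

theorem Delta_ι (v : V) : Delta K V (ι K v) = ι K v ⊗ₜ[K] 1 + 1 ⊗ₜ[K] ι K v := by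
  simp [Delta]

theorem Delta_of_mem_lambdaTwo {z : TensorAlgebra K V} (hz : z ∈ lambdaTwo K V) :
    Delta K V z = z ⊗ₜ[K] 1 + 1 ⊗ₜ[K] z := by
  induction hz using Submodule.span_induction with
  | mem x hx =>
    obtain ⟨v, w, rfl⟩ := hx
    simp only [map_sub, map_mul, Delta_ι, mul_add, add_mul, Algebra.TensorProduct.tmul_mul_tmul,
      one_mul, mul_one, TensorProduct.sub_tmul, TensorProduct.tmul_sub]
    abel
  | zero => simp
  | add x y _ _ hx hy =>
    rw [map_add, hx, hy, TensorProduct.add_tmul, TensorProduct.tmul_add]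
    abel
  | smul c x _ hx =>
    rw [map_smul, hx, smul_add, TensorProduct.smul_tmul', TensorProduct.tmul_smul]

end LambdaTwo

section Centralizer

open TensorAlgebra Polynomial

variable {F W : Type*} [Field F] [AddCommGroup W] [Module F W]

theorem aeval_tmul_aeval_mem_span (z : TensorAlgebra F W) (p q : F[X]) :
    aeval z p ⊗ₜ[F] aeval z q ∈ Submodule.span F
      {x : TensorAlgebra F W ⊗[F] TensorAlgebra F W | ∃ i j : ℕ, x = (z ^ i) ⊗ₜ[F] (z ^ j)} := by
  simp only [Polynomial.aeval_eq_sum_range, TensorProduct.sum_tmul, TensorProduct.tmul_sum]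
  refine Submodule.sum_mem _ fun i _ => Submodule.sum_mem _ fun j _ => ?_
  rw [TensorProduct.tmul_smul, ← TensorProduct.smul_tmul']
  exact Submodule.smul_mem _ _ (Submodule.smul_mem _ _ (Submodule.subset_span ⟨_, _, rfl⟩))

theorem commutator_eq_rTensor_add_lTensor (z : TensorAlgebra F W)
    (u : TensorAlgebra F W ⊗[F] TensorAlgebra F W) :
    (z ⊗ₜ[F] 1 + 1 ⊗ₜ[F] z) * u - u * (z ⊗ₜ[F] 1 + 1 ⊗ₜ[F] z)
      = (adMap z).rTensor _ u + (adMap z).lTensor _ u := by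
  induction u using TensorProduct.induction_on with
  | zero => simp
  | tmul x y =>
    simp only [LinearMap.rTensor_tmul, LinearMap.lTensor_tmul, adMap_apply, mul_add, add_mul,
      Algebra.TensorProduct.tmul_mul_tmul, one_mul, mul_one, TensorProduct.sub_tmul,
      TensorProduct.tmul_sub]
    abel
  | add x y hx hy =>
    rw [map_add, map_add, add_add_add_comm, ← hx, ← hy, mul_add _ x y, add_mul x y]
    abel

theorem centralizer_eq_span {z : TensorAlgebra F W} (hz0 : z ≠ 0) {d : ℕ} (hd : 0 < d)
    (hz : gradingHom z = C z * X ^ d) (hε : algebraMapInv z = 0) (hdiv : DivisionProperty z) :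
    {u : TensorAlgebra F W ⊗[F] TensorAlgebra F W |
        (z ⊗ₜ[F] 1 + 1 ⊗ₜ[F] z) * u - u * (z ⊗ₜ[F] 1 + 1 ⊗ₜ[F] z) = 0}
      = ↑(Submodule.span F
          {x : TensorAlgebra F W ⊗[F] TensorAlgebra F W |
            ∃ i j : ℕ, x = (z ^ i) ⊗ₜ[F] (z ^ j)}) := by
  ext u
  rw [Set.mem_ofPred_eq, SetLike.mem_coe, commutator_eq_rTensor_add_lTensor]
  constructor
  · intro hu
    have hker : ∀ x, adMap z (adMap z x) = 0 → adMap z x = 0 := fun x hx => by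
      obtain ⟨p, hp⟩ := exists_aeval_eq_of_commute hz0 hd hz hdiv _ hx
      exact adMap_eq_zero_of_eq_aeval hz0 hε hdiv _ p x le_rfl hp
    have h1 := rTensor_eq_zero_of_add_eq_zero (adMap z) hker truncation
      (truncation_adMap_pow hd hz) truncation_eq_self u hu
    have h2 : (adMap z).lTensor _ u = 0 := by rwa [h1, zero_add] at hu
    refine Submodule.span_le.mpr ?_ (mem_span_tmul_ker (adMap z) u h1 h2)
    rintro _ ⟨a, b, ha, hb, rfl⟩
    obtain ⟨p, rfl⟩ := exists_aeval_eq_of_commute hz0 hd hz hdiv a ha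
    obtain ⟨q, rfl⟩ := exists_aeval_eq_of_commute hz0 hd hz hdiv b hb
    exact aeval_tmul_aeval_mem_span z p q
  · intro hu
    induction hu using Submodule.span_induction with
    | mem x hx =>
      obtain ⟨i, j, rfl⟩ := hx
      simp [adMap_apply, ← pow_succ, ← pow_succ']
    | zero => simp
    | add x y _ _ hx hy => rw [map_add, map_add, add_add_add_comm, hx, hy, add_zero]
    | smul c x _ hx => rw [map_smul, map_smul, ← smul_add, hx, smul_zero]

end Centralizer

theorem stmt3 [FiniteDimensional K V] (z : TensorAlgebra K V) (hz : z ≠ 0)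
    (hz' : z ∈ LinearMap.range (TensorAlgebra.ι K : V →ₗ[K] TensorAlgebra K V)
         ∨ z ∈ lambdaTwo K V) :
    {u : TensorAlgebra K V ⊗[K] TensorAlgebra K V |
        Delta K V z * u - u * Delta K V z = 0}
      = ↑(Submodule.span K
          {x : TensorAlgebra K V ⊗[K] TensorAlgebra K V |
            ∃ i j : ℕ, x = (z ^ i) ⊗ₜ[K] (z ^ j)}) := by
  rcases hz' with ⟨v, rfl⟩ | hz'
  · rw [Delta_ι]
    exact centralizer_eq_span hz one_pos (by rw [gradingHom_ι, pow_one]) (algebraMapInv_ι v)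
      (divisionProperty_ι fun h => hz (by rw [h, map_zero]))
  · rw [Delta_of_mem_lambdaTwo hz']
    exact centralizer_eq_span hz two_pos (gradingHom_of_mem_lambdaTwo hz')
      (algebraMapInv_eq_zero_of_mem_lambdaTwo hz') (divisionProperty_of_mem_lambdaTwo hz hz')

end
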